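/- arXiv:1809.08124 — 3 statements merged into one kernel-verified Lean document; each statement's English description precedes it below -/
import Mathlib

section
/- For every real t > 0, every real ν, and every natural number n, the n-th derivative with respect to ν of Y_ν(t) equals (1/π)·∫₀^π xⁿ·sin(t·sin x − νx − nπ/2) dx − (1/π)·∫₀^∞ e^{−t·sinh x}·( xⁿ·e^{νx} + e^{−νx}·[pₙ(x)·cos(πν) − qₙ(x)·sin(πν)] ) dx. -/
open Real MeasureTheory

/-- Polynomial pₙ(x) = Re[(iπ − x)ⁿ]. -/
noncomputable def pPoly (n : ℕ) (x : ℝ) : ℝ :=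
  ∑ k ∈ Finset.range (n / 2 + 1),
    (n.choose (2 * k) : ℝ) * (-1) ^ (n + k) * π ^ (2 * k) * x ^ (n - 2 * k)

/-- Polynomial qₙ(x) = Im[(iπ − x)ⁿ]. -/
noncomputable def qPoly (n : ℕ) (x : ℝ) : ℝ :=
  ∑ k ∈ Finset.range ((n - 1) / 2 + 1),
    (n.choose (2 * k + 1) : ℝ) * (-1) ^ (n + k + 1) * π ^ (2 * k + 1) * x ^ (n - 2 * k - 1)

/-- Bessel function of the second kind via its integral representation. -/
noncomputable def besselY (ν t : ℝ) : ℝ :=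
  (1 / π) * ∫ x in (0:ℝ)..π, Real.sin (t * Real.sin x - ν * x)
    - (1 / π) * ∫ x in Set.Ioi (0:ℝ),
        Real.exp (-(t * Real.sinh x)) *
          (Real.exp (ν * x) + Real.exp (-(ν * x)) * Real.cos (ν * π))

/-- The `n`-th moment `∫ g wⁿ e^{νw} dμ` of the exponential family with weight `g` and exponent `w`. -/
noncomputable def expMoment (μ : Measure ℝ) (g w : ℝ → ℂ) (n : ℕ) (ν : ℝ) : ℂ :=
  ∫ x, g x * (w x ^ n * Complex.exp (ν * w x)) ∂μ

lemma norm_pow_mul_exp_le (z : ℂ) (n : ℕ) {ν R : ℝ} (h : |ν| ≤ R) :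
    ‖z ^ n * Complex.exp (ν * z)‖ ≤ n.factorial * Real.exp ((R + 1) * ‖z‖) := by
  have h1 : ‖z‖ ^ n ≤ n.factorial * Real.exp ‖z‖ := by
    have := Real.pow_div_factorial_le_exp ‖z‖ (norm_nonneg z) n
    rwa [div_le_iff₀' (by positivity)] at this
  have h2 : ‖Complex.exp (ν * z)‖ ≤ Real.exp (R * ‖z‖) := by
    refine (Complex.norm_exp_le_exp_norm _).trans (Real.exp_le_exp.2 ?_)
    rw [norm_mul, Complex.norm_real, Real.norm_eq_abs]
    gcongr
  calc ‖z ^ n * Complex.exp (ν * z)‖ = ‖z‖ ^ n * ‖Complex.exp (ν * z)‖ := by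
        rw [norm_mul, norm_pow]
    _ ≤ (n.factorial * Real.exp ‖z‖) * Real.exp (R * ‖z‖) := by gcongr
    _ = _ := by rw [mul_assoc, ← Real.exp_add]; ring_nf

lemma integrable_expMoment {μ : Measure ℝ} {g w : ℝ → ℂ} (hg : Continuous g) (hw : Continuous w)
    (hint : ∀ R : ℝ, Integrable (fun x => ‖g x‖ * Real.exp (R * ‖w x‖)) μ) (n : ℕ) (ν : ℝ) :
    Integrable (fun x => g x * (w x ^ n * Complex.exp (ν * w x))) μ := by
  refine ((hint (|ν| + 1)).const_mul (n.factorial : ℝ)).mono'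
    (Continuous.aestronglyMeasurable (by fun_prop)) (.of_forall fun x => ?_)
  rw [norm_mul, mul_left_comm]
  gcongr
  exact norm_pow_mul_exp_le _ _ le_rfl

lemma hasDerivAt_expMoment {μ : Measure ℝ} {g w : ℝ → ℂ} (hg : Continuous g) (hw : Continuous w)
    (hint : ∀ R : ℝ, Integrable (fun x => ‖g x‖ * Real.exp (R * ‖w x‖)) μ) (n : ℕ) (ν : ℝ) :
    HasDerivAt (expMoment μ g w n) (expMoment μ g w (n + 1) ν) ν := by
  refine (hasDerivAt_integral_of_dominated_loc_of_deriv_le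
    (F := fun (ν : ℝ) x => g x * (w x ^ n * Complex.exp (ν * w x)))
    (F' := fun (ν : ℝ) x => g x * (w x ^ (n + 1) * Complex.exp (ν * w x)))
    (bound := fun x => (n + 1).factorial * (‖g x‖ * Real.exp ((|ν| + 1 + 1) * ‖w x‖)))
    (Metric.ball_mem_nhds ν one_pos)
    (.of_forall fun _ => (integrable_expMoment hg hw hint n _).aestronglyMeasurable)
    (integrable_expMoment hg hw hint n ν)
    (integrable_expMoment hg hw hint (n + 1) ν).aestronglyMeasurable
    (.of_forall fun x y hy => ?_) ((hint _).const_mul _) (.of_forall fun x y _ => ?_)).2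
  · rw [norm_mul, mul_left_comm]
    gcongr
    refine norm_pow_mul_exp_le _ _ ?_
    rw [Metric.mem_ball, Real.dist_eq] at hy
    linarith [abs_sub_abs_le_abs_sub y ν]
  · have h := ((Complex.ofRealCLM.hasDerivAt (x := y)).mul_const (w x)).cexp
    refine ((h.const_mul (w x ^ n)).const_mul (g x)).congr_deriv ?_
    simp only [Complex.ofRealCLM_apply, Complex.ofReal_one]
    ring

lemma sq_div_four_le_sinh {x : ℝ} (hx : 0 ≤ x) : x ^ 2 / 4 ≤ Real.sinh x := by
  rw [Real.sinh_eq]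
  have h1 := Real.quadratic_le_exp_of_nonneg hx
  have h2 : Real.exp (-x) ≤ 1 := Real.exp_le_one_iff.2 (by linarith)
  linarith

lemma integrableOn_exp_neg_sinh_mul_exp {t : ℝ} (ht : 0 < t) {w : ℝ → ℂ} (hw : Continuous w)
    {c : ℝ} (hwc : ∀ x, 0 < x → ‖w x‖ ≤ x + c) (R : ℝ) :
    Integrable (fun x => ‖Complex.exp (-(t * Real.sinh x : ℝ))‖ * Real.exp (R * ‖w x‖))
      (volume.restrict (Set.Ioi 0)) := by
  have hdom : IntegrableOn
      (fun x : ℝ => Real.exp (|R| * c + (|R| + 1) ^ 2 / t) * Real.exp (-x)) (Set.Ioi 0) :=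
    (integrableOn_exp_neg_Ioi 0).const_mul _
  refine hdom.mono' (Continuous.aestronglyMeasurable (by fun_prop)) ?_
  filter_upwards [ae_restrict_mem measurableSet_Ioi] with x hx
  have hx : 0 < x := hx
  rw [norm_mul, norm_norm, Complex.norm_exp, Real.norm_eq_abs, Real.abs_exp, ← Real.exp_add,
    ← Real.exp_add, Real.exp_le_exp, ← Complex.ofReal_neg, Complex.ofReal_re]
  have h1 : R * ‖w x‖ ≤ |R| * (x + c) :=
    (mul_le_mul_of_nonneg_right (le_abs_self R) (norm_nonneg _)).trans
      (mul_le_mul_of_nonneg_left (hwc x hx) (abs_nonneg R))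
  have h2 : t * (x ^ 2 / 4) ≤ t * Real.sinh x :=
    mul_le_mul_of_nonneg_left (sq_div_four_le_sinh hx.le) ht.le
  have h3 : (|R| + 1) * x ≤ t * (x ^ 2 / 4) + (|R| + 1) ^ 2 / t := by
    have : t * (x ^ 2 / 4) + (|R| + 1) ^ 2 / t - (|R| + 1) * x
        = (t * x / 2 - (|R| + 1)) ^ 2 / t := by field_simp; ring
    have h0 : 0 ≤ (t * x / 2 - (|R| + 1)) ^ 2 / t := by positivity
    linarith
  linarith

lemma sum_range_two_mul {M : Type*} [AddCommMonoid M] (f : ℕ → M) (N : ℕ) :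
    ∑ m ∈ Finset.range (2 * N), f m
      = ∑ k ∈ Finset.range N, f (2 * k) + ∑ k ∈ Finset.range N, f (2 * k + 1) := by
  induction N with
  | zero => simp
  | succ N ih =>
    rw [mul_add, mul_one, Finset.sum_range_succ, Finset.sum_range_succ, ih,
      Finset.sum_range_succ, Finset.sum_range_succ]
    abel

lemma neg_add_pi_mul_I_pow (n : ℕ) (x : ℝ) :
    (-x + π * Complex.I : ℂ) ^ n = pPoly n x + qPoly n x * Complex.I := by
  have hsum : (-x + π * Complex.I : ℂ) ^ n = ∑ m ∈ Finset.range (2 * (n + 1)),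
      (π * Complex.I : ℂ) ^ m * (-x) ^ (n - m) * n.choose m := by
    rw [add_comm, add_pow]
    refine Finset.sum_subset (fun m hm => ?_) (fun m _ hm => ?_)
    · simp only [Finset.mem_range] at hm ⊢; omega
    · simp only [Finset.mem_range] at hm
      simp [Nat.choose_eq_zero_of_lt (show n < m by omega)]
  have hp : (pPoly n x : ℂ) = ∑ k ∈ Finset.range (n + 1),
      (π * Complex.I : ℂ) ^ (2 * k) * (-x) ^ (n - 2 * k) * n.choose (2 * k) := by
    rw [pPoly, Complex.ofReal_sum]
    refine (Finset.sum_congr rfl fun k hk => ?_).trans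
      (Finset.sum_subset (fun k hk => ?_) fun k _ hk => ?_)
    · simp only [Finset.mem_range] at hk
      have hs : (-1 : ℂ) ^ (n + k) = (-1) ^ k * (-1) ^ (n - 2 * k) := by
        rw [← pow_add, show n + k = k + (n - 2 * k) + 2 * k by omega, pow_add _ _ (2 * k)]
        simp
      push_cast
      rw [hs, mul_pow, pow_mul Complex.I, Complex.I_sq, neg_pow (x : ℂ)]
      ring
    · simp only [Finset.mem_range] at hk ⊢; omega
    · simp only [Finset.mem_range] at hk
      simp [Nat.choose_eq_zero_of_lt (show n < 2 * k by omega)]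
  have hq : (qPoly n x * Complex.I : ℂ) = ∑ k ∈ Finset.range (n + 1),
      (π * Complex.I : ℂ) ^ (2 * k + 1) * (-x) ^ (n - (2 * k + 1)) * n.choose (2 * k + 1) := by
    rw [qPoly, Complex.ofReal_sum, Finset.sum_mul]
    refine (Finset.sum_congr rfl fun k hk => ?_).trans
      (Finset.sum_subset (fun k hk => ?_) fun k _ hk => ?_)
    · rcases Nat.lt_or_ge n (2 * k + 1) with h | h
      · simp [Nat.choose_eq_zero_of_lt h]
      have hs : (-1 : ℂ) ^ (n + k + 1) = (-1) ^ k * (-1) ^ (n - (2 * k + 1)) := by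
        rw [← pow_add, show n + k + 1 = k + (n - (2 * k + 1)) + 2 * (k + 1) by omega,
          pow_add _ _ (2 * (k + 1))]
        simp
      push_cast
      rw [hs, mul_pow, pow_succ Complex.I, pow_mul Complex.I, Complex.I_sq, neg_pow (x : ℂ),
        Nat.sub_sub]
      ring
    · simp only [Finset.mem_range] at hk ⊢; omega
    · simp only [Finset.mem_range] at hk
      simp [Nat.choose_eq_zero_of_lt (show n < 2 * k + 1 by omega)]
  rw [hsum, sum_range_two_mul, hp, hq]

lemma integral_pow_mul_sin_eq (t ν : ℝ) (n : ℕ) :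
    ∫ x in (0:ℝ)..π, x ^ n * Real.sin (t * Real.sin x - ν * x - n * π / 2)
      = (expMoment (volume.restrict (Set.Ioc 0 π))
          (fun x => Complex.exp ((t * Real.sin x : ℝ) * Complex.I))
          (fun x => -x * Complex.I) n ν).im := by
  have hI : (-Complex.I) ^ n = Complex.exp (-(n * π / 2 : ℝ) * Complex.I) := by
    have h : -Complex.I = Complex.exp (-(π / 2 * Complex.I)) := by
      rw [Complex.exp_neg, Complex.exp_pi_div_two_mul_I, Complex.inv_I]
    rw [h, ← Complex.exp_nat_mul]
    congr 1
    push_cast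
    ring
  have hint : Integrable (fun x : ℝ => Complex.exp ((t * Real.sin x : ℝ) * Complex.I) *
      ((-x * Complex.I) ^ n * Complex.exp (ν * (-x * Complex.I))))
      (volume.restrict (Set.Ioc 0 π)) :=
    (Continuous.integrableOn_Icc (by fun_prop)).mono_set Set.Ioc_subset_Icc_self
  rw [expMoment, intervalIntegral.integral_of_le Real.pi_pos.le, ← Complex.imCLM_apply,
    ← Complex.imCLM.integral_comp_comm hint]
  refine integral_congr_ae (.of_forall fun x => ?_)
  have : Complex.exp ((t * Real.sin x : ℝ) * Complex.I) *
      ((-x * Complex.I) ^ n * Complex.exp (ν * (-x * Complex.I)))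
      = (x ^ n : ℝ) *
        Complex.exp ((t * Real.sin x - ν * x - n * π / 2 : ℝ) * Complex.I) := by
    rw [show (-x * Complex.I : ℂ) ^ n = x ^ n * (-Complex.I) ^ n by rw [← mul_pow]; ring, hI,
      mul_assoc, mul_left_comm, ← Complex.exp_add, ← Complex.exp_add]
    push_cast
    ring_nf
  simp only [Complex.imCLM_apply]
  rw [this, Complex.im_ofReal_mul, Complex.exp_ofReal_mul_I_im]

lemma norm_neg_add_pi_mul_I_le {x : ℝ} (hx : 0 < x) : ‖(-x + π * Complex.I : ℂ)‖ ≤ x + π := by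
  refine (norm_add_le _ _).trans_eq ?_
  simp [abs_of_pos hx, abs_of_pos Real.pi_pos]

lemma integral_exp_neg_sinh_mul_eq {t : ℝ} (ht : 0 < t) (ν : ℝ) (n : ℕ) :
    ∫ x in Set.Ioi (0:ℝ), Real.exp (-(t * Real.sinh x)) *
        (x ^ n * Real.exp (ν * x) + Real.exp (-(ν * x)) *
          (pPoly n x * Real.cos (π * ν) - qPoly n x * Real.sin (π * ν)))
      = (expMoment (volume.restrict (Set.Ioi 0))
            (fun x => Complex.exp (-(t * Real.sinh x : ℝ))) (fun x => x) n ν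
          + expMoment (volume.restrict (Set.Ioi 0))
            (fun x => Complex.exp (-(t * Real.sinh x : ℝ)))
            (fun x => -x + π * Complex.I) n ν).re := by
  have hint₁ := integrable_expMoment (g := fun x : ℝ => Complex.exp (-(t * Real.sinh x : ℝ)))
    (by fun_prop) (by fun_prop) (integrableOn_exp_neg_sinh_mul_exp ht (w := fun x => (x : ℂ))
      (by fun_prop) (c := 0) (fun x hx => by simp [abs_of_pos hx])) n ν
  have hint₂ := integrable_expMoment (g := fun x : ℝ => Complex.exp (-(t * Real.sinh x : ℝ)))
    (by fun_prop) (by fun_prop) (integrableOn_exp_neg_sinh_mul_exp ht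
      (w := fun x => (-x + π * Complex.I : ℂ))
      (by fun_prop) (c := π) (fun x hx => norm_neg_add_pi_mul_I_le hx)) n ν
  rw [expMoment, expMoment, ← integral_add hint₁ hint₂, ← Complex.reCLM_apply]
  refine Eq.trans ?_ (Complex.reCLM.integral_comp_comm (hint₁.add hint₂))
  refine integral_congr_ae (.of_forall fun x => ?_)
  have h : Complex.exp (ν * (-x + π * Complex.I))
      = (Real.exp (-(ν * x)) : ℝ) * Complex.exp ((π * ν : ℝ) * Complex.I) := by
    rw [Complex.ofReal_exp, ← Complex.exp_add]
    push_cast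
    ring_nf
  simp only [Complex.reCLM_apply]
  rw [← mul_add, neg_add_pi_mul_I_pow, h, ← Complex.ofReal_neg, ← Complex.ofReal_exp,
    Complex.re_ofReal_mul, ← Complex.ofReal_mul, ← Complex.ofReal_exp, ← Complex.ofReal_pow,
    ← Complex.ofReal_mul, Complex.add_re, Complex.ofReal_re, mul_left_comm,
    Complex.re_ofReal_mul, Complex.mul_re, Complex.exp_ofReal_mul_I_re,
    Complex.exp_ofReal_mul_I_im]
  simp

/-- Subtracting a constant under the mean over `[0, π]` subtracts it from the mean. -/
lemma one_div_pi_mul_integral_sub_const {f : ℝ → ℝ} (hf : Continuous f) (c : ℝ) :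
    (1 / π) * ∫ x in (0:ℝ)..π, (f x - c) = (1 / π) * (∫ x in (0:ℝ)..π, f x) - c := by
  rw [intervalIntegral.integral_sub (hf.intervalIntegrable _ _) intervalIntegrable_const,
    intervalIntegral.integral_const, smul_eq_mul, sub_zero, mul_sub, ← mul_assoc,
    one_div_mul_cancel Real.pi_ne_zero, one_mul]

lemma besselY_eq_order_zero (ν t : ℝ) :
    besselY ν t
      = (1 / π) * ∫ x in (0:ℝ)..π, x ^ 0 * Real.sin (t * Real.sin x - ν * x - (0 : ℕ) * π / 2)
        - (1 / π) * ∫ x in Set.Ioi (0:ℝ),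
            Real.exp (-(t * Real.sinh x)) *
              (x ^ 0 * Real.exp (ν * x) +
                Real.exp (-(ν * x)) *
                  (pPoly 0 x * Real.cos (π * ν) - qPoly 0 x * Real.sin (π * ν))) := by
  simp [besselY, pPoly, qPoly, mul_comm ν π]

theorem iteratedDeriv_besselY_order (t : ℝ) (ht : 0 < t) (ν : ℝ) (n : ℕ) :
    iteratedDeriv n (fun ν : ℝ => besselY ν t) ν
      = (1 / π) * ∫ x in (0:ℝ)..π, x ^ n * Real.sin (t * Real.sin x - ν * x - n * π / 2)
        - (1 / π) * ∫ x in Set.Ioi (0:ℝ),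
            Real.exp (-(t * Real.sinh x)) *
              (x ^ n * Real.exp (ν * x) +
                Real.exp (-(ν * x)) *
                  (pPoly n x * Real.cos (π * ν) - qPoly n x * Real.sin (π * ν))) := by
  induction n generalizing ν with
  | zero => rw [iteratedDeriv_zero]; exact besselY_eq_order_zero ν t
  | succ n ih =>
    rw [iteratedDeriv_succ, funext ih]
    have hsin (m : ℕ) (ν c : ℝ) := one_div_pi_mul_integral_sub_const
      (f := fun x => x ^ m * Real.sin (t * Real.sin x - ν * x - m * π / 2)) (by fun_prop) c
    simp only [hsin, integral_pow_mul_sin_eq, integral_exp_neg_sinh_mul_eq ht]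
    have h₁ := hasDerivAt_expMoment (μ := volume.restrict (Set.Ioc 0 π))
      (g := fun x : ℝ => Complex.exp ((t * Real.sin x : ℝ) * Complex.I))
      (w := fun x : ℝ => -x * Complex.I) (by fun_prop) (by fun_prop)
      (fun R => (Continuous.integrableOn_Icc (by fun_prop)).mono_set Set.Ioc_subset_Icc_self) n ν
    have h₂ := hasDerivAt_expMoment (g := fun x : ℝ => Complex.exp (-(t * Real.sinh x : ℝ)))
      (by fun_prop) (by fun_prop) (integrableOn_exp_neg_sinh_mul_exp ht (w := fun x => (x : ℂ))
        (by fun_prop) (c := 0) (fun x hx => by simp [abs_of_pos hx])) n ν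
    have h₃ := hasDerivAt_expMoment (g := fun x : ℝ => Complex.exp (-(t * Real.sinh x : ℝ)))
      (by fun_prop) (by fun_prop) (integrableOn_exp_neg_sinh_mul_exp ht
        (w := fun x => (-x + π * Complex.I : ℂ))
        (by fun_prop) (c := π) (fun x hx => norm_neg_add_pi_mul_I_le hx)) n ν
    exact (((Complex.imCLM.hasFDerivAt.comp_hasDerivAt ν h₁).const_mul (1 / π)).sub
      ((Complex.reCLM.hasFDerivAt.comp_hasDerivAt ν (h₂.add h₃)).const_mul (1 / π))).deriv
end

section
/- For every real t > 0, every real ν, and every natural number n, the n-th derivative with respect to ν of K_ν(t) equals (1/2)·∫_{−∞}^{∞} xⁿ·e^{νx − t·cosh x} dx. -/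
open Real MeasureTheory

/-- Modified Bessel function of the second kind (Macdonald function). -/
noncomputable def besselK (ν t : ℝ) : ℝ :=
  (1 / 2) * ∫ x : ℝ, Real.exp (ν * x - t * Real.cosh x)

open ProbabilityTheory

/-- A quadratic lower bound for the hyperbolic cosine. -/
lemma sq_div_four_le_cosh (x : ℝ) : x ^ 2 / 4 ≤ Real.cosh x := by
  have h := Real.quadratic_le_exp_of_nonneg (abs_nonneg x)
  rw [sq_abs] at h
  rw [← Real.cosh_abs, Real.cosh_eq]
  linarith [abs_nonneg x, Real.exp_pos (-|x|)]

/-- The integrand defining the Macdonald function is integrable. -/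
lemma integrable_exp_mul_sub_mul_cosh {t : ℝ} (ht : 0 < t) (ν : ℝ) :
    Integrable fun x : ℝ => Real.exp (ν * x - t * Real.cosh x) := by
  refine ((integrable_exp_neg_mul_sq (b := t / 8) (by positivity)).const_mul
    (Real.exp (2 * ν ^ 2 / t))).mono' (by fun_prop) (ae_of_all _ fun x => ?_)
  rw [Real.norm_of_nonneg (Real.exp_nonneg _), ← Real.exp_add, Real.exp_le_exp]
  have hcosh := mul_le_mul_of_nonneg_left (sq_div_four_le_cosh x) ht.le
  have hsq : 2 * ν ^ 2 / t + -(t / 8) * x ^ 2 - (ν * x - t * (x ^ 2 / 4))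
      = t / 8 * (x - 4 * ν / t) ^ 2 := by
    field_simp
    ring
  have : 0 ≤ t / 8 * (x - 4 * ν / t) ^ 2 := by positivity
  linarith

/-- The measure on `ℝ` with Lebesgue density `x ↦ exp (-t * cosh x)`; its moment generating
function is twice the Macdonald function, as a function of the order. -/
noncomputable def expNegCoshMeasure (t : ℝ) : Measure ℝ :=
  volume.withDensity fun x => ENNReal.ofReal (Real.exp (-t * Real.cosh x))

lemma integral_mul_exp_expNegCoshMeasure (t ν : ℝ) (f : ℝ → ℝ) :
    ∫ x, f x * Real.exp (ν * x) ∂expNegCoshMeasure t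
      = ∫ x, f x * Real.exp (ν * x - t * Real.cosh x) := by
  rw [expNegCoshMeasure, integral_withDensity_eq_integral_toReal_smul (by fun_prop) (by simp)]
  refine integral_congr_ae (ae_of_all _ fun x => ?_)
  simp only [ENNReal.toReal_ofReal (Real.exp_nonneg _), smul_eq_mul, sub_eq_add_neg, Real.exp_add,
    neg_mul]
  ring

lemma integrableExpSet_expNegCoshMeasure {t : ℝ} (ht : 0 < t) :
    integrableExpSet id (expNegCoshMeasure t) = Set.univ := by
  refine Set.eq_univ_of_forall fun ν => ?_
  change Integrable (fun x : ℝ => Real.exp (ν * x)) (expNegCoshMeasure t)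
  rw [expNegCoshMeasure, integrable_withDensity_iff (by fun_prop) (by simp)]
  refine (integrable_exp_mul_sub_mul_cosh ht ν).congr (ae_of_all _ fun x => ?_)
  simp only [ENNReal.toReal_ofReal (Real.exp_nonneg _), ← Real.exp_add, neg_mul, sub_eq_add_neg]

lemma besselK_eq_mgf (ν t : ℝ) : besselK ν t = 1 / 2 * mgf id (expNegCoshMeasure t) ν := by
  simpa [besselK, mgf] using (integral_mul_exp_expNegCoshMeasure t ν fun _ => 1).symm

theorem iteratedDeriv_besselK_order (t : ℝ) (ht : 0 < t) (ν : ℝ) (n : ℕ) :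
    iteratedDeriv n (fun ν : ℝ => besselK ν t) ν
      = (1 / 2) * ∫ x : ℝ, x ^ n * Real.exp (ν * x - t * Real.cosh x) := by
  have hν : ν ∈ interior (integrableExpSet id (expNegCoshMeasure t)) := by
    simp [integrableExpSet_expNegCoshMeasure ht]
  simp_rw [besselK_eq_mgf]
  rw [iteratedDeriv_const_mul_field, iteratedDeriv_mgf hν]
  simp only [id, integral_mul_exp_expNegCoshMeasure t ν (fun x => x ^ n)]
end

section
/- For every real t > 0 and every natural number m ≥ 1, (∂²Y_ν(t)/∂ν²)|_{ν=m} + (−1)^{m+1}·(∂²Y_ν(t)/∂ν²)|_{ν=−m} = −π·m!·Σ_{k=0}^{m−1} [J_k(t)/(k!·(m−k))]·(t/2)^{k−m}. -/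
open Real MeasureTheory

/-- Bessel function of the first kind via Schläfli's integral representation. -/
noncomputable def besselJ (ν t : ℝ) : ℝ :=
  (1 / π) * ∫ x in (0:ℝ)..π, Real.cos (t * Real.sin x - ν * x)
    - (Real.sin (ν * π) / π) * ∫ x in Set.Ioi (0:ℝ), Real.exp (-(t * Real.sinh x) - ν * x)

open Set Filter Topology

/-- The exponential integral `∫₀^∞ exp (-t sinh x + ν x) dx` occurring in Schläfli's formulas. -/
noncomputable def schlaefliExp (t ν : ℝ) : ℝ :=
  ∫ x in Ioi (0:ℝ), rexp (-(t * sinh x)) * rexp (ν * x)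

/-- The value of `2 ∂J_ν(t)/∂ν - π Y_ν(t)` at the integer order `ν = n`. -/
noncomputable def besselDefect (t : ℝ) (n : ℤ) : ℝ :=
  2 / π * (∫ x in (0:ℝ)..π, (x - π / 2) * Real.sin (t * Real.sin x - n * x))
    + (schlaefliExp t n - (-1) ^ n * schlaefliExp t (-n))

/-! ### The exponential integral -/

lemma eventually_exp_neg_sinh_mul_exp_le {t : ℝ} (ht : 0 < t) (ν : ℝ) :
    ∀ᶠ x in atTop, rexp (-(t * sinh x)) * rexp (ν * x) ≤ rexp (-1 * x) := by
  filter_upwards [eventually_ge_atTop (4 * (|ν| + 1) / t), eventually_ge_atTop 0] with x hx hx0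
  rw [← Real.exp_add, Real.exp_le_exp]
  have hsinh : x ^ 2 / 4 ≤ sinh x := by
    rw [Real.sinh_eq]
    have h₁ := Real.quadratic_le_exp_of_nonneg hx0
    have h₂ : rexp (-x) ≤ 1 := Real.exp_le_one_iff.2 (by linarith)
    linarith
  rw [div_le_iff₀ ht] at hx
  have h₃ : t * (x ^ 2 / 4) ≤ t * sinh x := by gcongr
  have h₄ := mul_le_mul_of_nonneg_right hx hx0
  have h₅ : ν * x ≤ |ν| * x := by gcongr; exact le_abs_self ν
  nlinarith

lemma integrableOn_exp_neg_sinh_mul_exp_s13 {t : ℝ} (ht : 0 < t) (ν : ℝ) :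
    IntegrableOn (fun x => rexp (-(t * sinh x)) * rexp (ν * x)) (Ioi 0) := by
  refine integrable_of_isBigO_exp_neg one_pos (by fun_prop) ?_
  refine Asymptotics.IsBigO.of_bound 1 ?_
  filter_upwards [eventually_exp_neg_sinh_mul_exp_le ht ν] with x hx
  rw [Real.norm_of_nonneg (by positivity), Real.norm_of_nonneg (by positivity), one_mul]
  exact hx

lemma tendsto_exp_neg_sinh_mul_exp {t : ℝ} (ht : 0 < t) (ν : ℝ) :
    Tendsto (fun x => rexp (-(t * sinh x)) * rexp (ν * x)) atTop (𝓝 0) := by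
  refine squeeze_zero' (Eventually.of_forall fun x => by positivity)
    (eventually_exp_neg_sinh_mul_exp_le ht ν) ?_
  simpa using Real.tendsto_exp_neg_atTop_nhds_zero

lemma contDiff_schlaefliExp {t : ℝ} (ht : 0 < t) : ContDiff ℝ 2 (schlaefliExp t) := by
  let w : ℝ → NNReal := fun x => ⟨rexp (-(t * sinh x)), (Real.exp_pos _).le⟩
  have hw : Measurable w := by
    refine Measurable.subtype_mk ?_
    exact Continuous.measurable (by fun_prop)
  let μ : Measure ℝ := (volume.restrict (Ioi 0)).withDensity fun x => w x
  have hE : schlaefliExp t = ProbabilityTheory.mgf id μ := by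
    ext ν
    simp only [ProbabilityTheory.mgf, μ]
    rw [integral_withDensity_eq_integral_smul hw]
    rfl
  have hset : ProbabilityTheory.integrableExpSet id μ = univ := by
    refine eq_univ_of_forall fun ν => ?_
    simp only [ProbabilityTheory.integrableExpSet, mem_ofPred_eq, μ]
    rw [integrable_withDensity_iff_integrable_smul hw]
    exact integrableOn_exp_neg_sinh_mul_exp_s13 ht ν
  rw [contDiff_iff_contDiffAt, hE]
  exact fun ν => (ProbabilityTheory.analyticAt_mgf (by simp [hset])).contDiffAt

lemma schlaefliExp_recurrence {t : ℝ} (ht : 0 < t) (ν : ℝ) :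
    schlaefliExp t (ν + 1) + schlaefliExp t (ν - 1) - 2 * ν / t * schlaefliExp t ν = 2 / t := by
  have hplus := integrableOn_exp_neg_sinh_mul_exp_s13 ht (ν + 1)
  have hminus := integrableOn_exp_neg_sinh_mul_exp_s13 ht (ν - 1)
  have hmid := (integrableOn_exp_neg_sinh_mul_exp_s13 ht ν).const_mul (2 * ν / t)
  have key := integral_Ioi_of_hasDerivAt_of_tendsto' (a := 0)
    (f := fun x => -(2 / t) * (rexp (-(t * sinh x)) * rexp (ν * x)))
    (f' := fun x => rexp (-(t * sinh x)) * rexp ((ν + 1) * x)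
      + rexp (-(t * sinh x)) * rexp ((ν - 1) * x)
      - 2 * ν / t * (rexp (-(t * sinh x)) * rexp (ν * x))) (m := -(2 / t) * 0)
    (fun x _ => by
      have h₁ : HasDerivAt (fun x => rexp (-(t * sinh x)))
          (rexp (-(t * sinh x)) * (-(t * cosh x))) x :=
        ((Real.hasDerivAt_sinh x).const_mul t).neg.exp
      have h₂ : HasDerivAt (fun x => rexp (ν * x)) (rexp (ν * x) * (ν * 1)) x :=
        ((hasDerivAt_id x).const_mul ν).exp
      refine ((h₁.mul h₂).const_mul (-(2 / t))).congr_deriv ?_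
      rw [Real.cosh_eq, show (ν + 1) * x = ν * x + x by ring,
        show (ν - 1) * x = ν * x + -x by ring, Real.exp_add (ν * x), Real.exp_add (ν * x)]
      field_simp
      ring)
    ((hplus.add hminus).sub hmid)
    ((tendsto_exp_neg_sinh_mul_exp ht ν).const_mul _)
  have hsub := integral_sub (hplus.add hminus) hmid
  simp only [Pi.add_apply] at hsub
  rw [hsub, integral_add hplus hminus, integral_const_mul] at key
  simpa [schlaefliExp] using key

/-! ### The trigonometric integrals -/

lemma hasDerivAt_integral_mul_cos {w a : ℝ → ℝ} (hw : Continuous w) (ha : Continuous a) (ν : ℝ) :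
    HasDerivAt (fun ν => ∫ x in (0:ℝ)..π, w x * Real.cos (a x - ν * x))
      (∫ x in (0:ℝ)..π, (x * w x) * Real.cos ((a x - π / 2) - ν * x)) ν := by
  refine (intervalIntegral.hasDerivAt_integral_of_dominated_loc_of_deriv_le
    (F := fun ν x => w x * Real.cos (a x - ν * x))
    (F' := fun ν x => (x * w x) * Real.cos ((a x - π / 2) - ν * x))
    (bound := fun x => |x * w x|) univ_mem (Eventually.of_forall fun y => ?_) ?_ ?_ ?_ ?_ ?_).2
  · exact Continuous.aestronglyMeasurable (by fun_prop)
  · exact Continuous.intervalIntegrable (by fun_prop) _ _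
  · exact Continuous.aestronglyMeasurable (by fun_prop)
  · refine Eventually.of_forall fun x _ y _ => ?_
    rw [norm_mul, Real.norm_eq_abs, Real.norm_eq_abs]
    exact mul_le_of_le_one_right (abs_nonneg _) (Real.abs_cos_le_one _)
  · exact Continuous.intervalIntegrable (by fun_prop) _ _
  · refine Eventually.of_forall fun x _ y _ => ?_
    have h : HasDerivAt (fun y => a x - y * x) (-(1 * x)) y :=
      ((hasDerivAt_id y).mul_const x).const_sub (a x)
    refine (h.cos.const_mul (w x)).congr_deriv ?_
    rw [show a x - π / 2 - y * x = (a x - y * x) - π / 2 by ring, Real.cos_sub_pi_div_two]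
    ring

lemma contDiff_integral_mul_cos (n : ℕ) : ∀ {w a : ℝ → ℝ}, Continuous w → Continuous a →
    ContDiff ℝ n (fun ν => ∫ x in (0:ℝ)..π, w x * Real.cos (a x - ν * x)) := by
  induction n with
  | zero =>
    intro w a hw ha
    exact contDiff_zero.2 (continuous_iff_continuousAt.2 fun ν =>
      (hasDerivAt_integral_mul_cos hw ha ν).continuousAt)
  | succ n ih =>
    intro w a hw ha
    rw [Nat.cast_succ, contDiff_succ_iff_deriv]
    refine ⟨fun ν => (hasDerivAt_integral_mul_cos hw ha ν).differentiableAt, by simp, ?_⟩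
    rw [funext fun ν => (hasDerivAt_integral_mul_cos hw ha ν).deriv]
    exact ih (by fun_prop) (by fun_prop)

lemma contDiff_integral_cos (t : ℝ) :
    ContDiff ℝ 2 (fun ν => ∫ x in (0:ℝ)..π, Real.cos (t * Real.sin x - ν * x)) := by
  simpa using contDiff_integral_mul_cos 2 (w := fun _ => 1) (a := fun x => t * Real.sin x)
    (by fun_prop) (by fun_prop)

lemma contDiff_integral_sin (t : ℝ) :
    ContDiff ℝ 2 (fun ν => ∫ x in (0:ℝ)..π, Real.sin (t * Real.sin x - ν * x)) := by
  have h := contDiff_integral_mul_cos 2 (w := fun _ => 1) (a := fun x => t * Real.sin x - π / 2)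
    (by fun_prop) (by fun_prop)
  simpa [sub_right_comm _ (π / 2), Real.cos_sub_pi_div_two] using h

lemma hasDerivAt_integral_cos (t ν : ℝ) :
    HasDerivAt (fun ν => ∫ x in (0:ℝ)..π, Real.cos (t * Real.sin x - ν * x))
      (∫ x in (0:ℝ)..π, x * Real.sin (t * Real.sin x - ν * x)) ν := by
  have h := hasDerivAt_integral_mul_cos (w := fun _ => 1) (a := fun x => t * Real.sin x)
    (by fun_prop) (by fun_prop) ν
  simpa [sub_right_comm _ (π / 2), Real.cos_sub_pi_div_two] using h

lemma integral_sin_neg_order (t ν : ℝ) :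
    ∫ x in (0:ℝ)..π, Real.sin (t * Real.sin x - -ν * x)
      = Real.sin (ν * π) * (∫ x in (0:ℝ)..π, Real.cos (t * Real.sin x - ν * x))
        + Real.cos (ν * π) * ∫ x in (0:ℝ)..π, Real.sin (t * Real.sin x - ν * x) := by
  rw [← intervalIntegral.integral_const_mul, ← intervalIntegral.integral_const_mul,
    ← intervalIntegral.integral_add (Continuous.intervalIntegrable (by fun_prop) _ _)
      (Continuous.intervalIntegrable (by fun_prop) _ _)]
  have h := intervalIntegral.integral_comp_sub_left
    (fun x => Real.sin (t * Real.sin x - -ν * x)) (a := 0) (b := π) π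
  rw [sub_self, sub_zero] at h
  rw [← h]
  refine intervalIntegral.integral_congr fun x _ => ?_
  simp only [Real.sin_pi_sub]
  rw [show t * Real.sin x - -ν * (π - x) = ν * π + (t * Real.sin x - ν * x) by ring, Real.sin_add]

/-! ### The Bessel functions in terms of these integrals -/

lemma besselJ_eq (ν t : ℝ) :
    besselJ ν t = 1 / π * (∫ x in (0:ℝ)..π, Real.cos (t * Real.sin x - ν * x))
      - Real.sin (ν * π) / π * schlaefliExp t (-ν) := by
  have h : ∫ x in Ioi (0:ℝ), rexp (-(t * sinh x) - ν * x) = schlaefliExp t (-ν) := by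
    simp only [schlaefliExp, ← Real.exp_add, neg_mul, sub_eq_add_neg]
  rw [besselJ, h, intervalIntegral.integral_sub (Continuous.intervalIntegrable (by fun_prop) _ _)
    (Continuous.intervalIntegrable (by fun_prop) _ _), intervalIntegral.integral_const, mul_sub,
    smul_eq_mul, sub_zero, one_div, inv_mul_cancel_left₀ Real.pi_ne_zero]

lemma besselY_eq {t : ℝ} (ht : 0 < t) (ν : ℝ) :
    besselY ν t = 1 / π * (∫ x in (0:ℝ)..π, Real.sin (t * Real.sin x - ν * x))
      - 1 / π * (schlaefliExp t ν + Real.cos (ν * π) * schlaefliExp t (-ν)) := by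
  have h := integral_add (integrableOn_exp_neg_sinh_mul_exp_s13 ht ν)
    ((integrableOn_exp_neg_sinh_mul_exp_s13 ht (-ν)).const_mul (Real.cos (ν * π)))
  rw [integral_const_mul] at h
  have h' : ∫ x in Ioi (0:ℝ), rexp (-(t * sinh x)) *
      (rexp (ν * x) + rexp (-(ν * x)) * Real.cos (ν * π))
      = schlaefliExp t ν + Real.cos (ν * π) * schlaefliExp t (-ν) := by
    rw [schlaefliExp, schlaefliExp, ← h]
    congr 1 with x
    rw [neg_mul]
    ring
  rw [besselY, h', intervalIntegral.integral_sub
    (Continuous.intervalIntegrable (by fun_prop) _ _)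
    (Continuous.intervalIntegrable (by fun_prop) _ _), intervalIntegral.integral_const, mul_sub,
    smul_eq_mul, sub_zero, one_div, inv_mul_cancel_left₀ Real.pi_ne_zero]

lemma besselY_neg_order {t : ℝ} (ht : 0 < t) (ν : ℝ) :
    besselY (-ν) t = Real.sin (ν * π) * besselJ ν t + Real.cos (ν * π) * besselY ν t := by
  rw [besselY_eq ht, besselY_eq ht, besselJ_eq, integral_sin_neg_order, neg_neg, neg_mul,
    Real.cos_neg]
  linear_combination 1 / π * schlaefliExp t (-ν) * Real.sin_sq_add_cos_sq (ν * π)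

lemma contDiff_besselJ {t : ℝ} (ht : 0 < t) : ContDiff ℝ 2 (fun ν => besselJ ν t) := by
  simp only [besselJ_eq]
  have hC := contDiff_integral_cos t
  have hE := (contDiff_schlaefliExp ht).comp (contDiff_neg (n := 2))
  have hs : ContDiff ℝ 2 (fun ν : ℝ => Real.sin (ν * π) / π) := by fun_prop
  exact (contDiff_const.mul hC).sub (hs.mul hE)

lemma contDiff_besselY {t : ℝ} (ht : 0 < t) : ContDiff ℝ 2 (fun ν => besselY ν t) := by
  simp only [besselY_eq ht]
  have hS := contDiff_integral_sin t
  have hE := contDiff_schlaefliExp ht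
  have hc : ContDiff ℝ 2 (fun ν : ℝ => Real.cos (ν * π)) := by fun_prop
  exact (contDiff_const.mul hS).sub
    (contDiff_const.mul (hE.add (hc.mul (hE.comp (contDiff_neg (n := 2))))))

lemma besselJ_intCast (n : ℤ) (t : ℝ) :
    besselJ n t = 1 / π * ∫ x in (0:ℝ)..π, Real.cos (t * Real.sin x - n * x) := by
  rw [besselJ_eq, Real.sin_int_mul_pi, zero_div, zero_mul, sub_zero]

lemma hasDerivAt_besselJ_intCast {t : ℝ} (ht : 0 < t) (n : ℤ) :
    HasDerivAt (fun ν => besselJ ν t)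
      (1 / π * (∫ x in (0:ℝ)..π, x * Real.sin (t * Real.sin x - n * x))
        - (-1) ^ n * schlaefliExp t (-n)) n := by
  simp only [besselJ_eq]
  have hE : HasDerivAt (fun ν => schlaefliExp t (-ν)) _ (n : ℝ) :=
    (((contDiff_schlaefliExp ht).comp (contDiff_neg (n := 2))).differentiable
      (by norm_num) (n : ℝ)).hasDerivAt
  have hs : HasDerivAt (fun ν : ℝ => Real.sin (ν * π) / π)
      (Real.cos (n * π) * (1 * π) / π) (n : ℝ) :=
    (((hasDerivAt_id (n : ℝ)).mul_const π).sin).div_const π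
  refine (((hasDerivAt_integral_cos t n).const_mul (1 / π)).sub (hs.mul hE)).congr_deriv ?_
  rw [Real.sin_int_mul_pi, Real.cos_int_mul_pi, zero_div, zero_mul, add_zero, one_mul,
    mul_div_cancel_right₀ _ Real.pi_ne_zero]

lemma two_mul_deriv_besselJ_sub_pi_mul_besselY {t : ℝ} (ht : 0 < t) (n : ℤ) :
    2 * deriv (fun ν => besselJ ν t) n - π * besselY n t = besselDefect t n := by
  have hsplit : ∫ x in (0:ℝ)..π, (x - π / 2) * Real.sin (t * Real.sin x - n * x)
      = (∫ x in (0:ℝ)..π, x * Real.sin (t * Real.sin x - n * x))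
        - π / 2 * ∫ x in (0:ℝ)..π, Real.sin (t * Real.sin x - n * x) := by
    rw [← intervalIntegral.integral_const_mul, ← intervalIntegral.integral_sub
      (Continuous.intervalIntegrable (by fun_prop) _ _)
      (Continuous.intervalIntegrable (by fun_prop) _ _)]
    simp only [sub_mul]
  rw [(hasDerivAt_besselJ_intCast ht n).deriv, besselY_eq ht, besselDefect, hsplit,
    Real.cos_int_mul_pi]
  linear_combination (schlaefliExp t n + (-1) ^ n * schlaefliExp t (-n)) *
    mul_inv_cancel₀ Real.pi_ne_zero

/-! ### Recurrences at integer orders -/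

lemma hasDerivAt_phase (t ν x : ℝ) :
    HasDerivAt (fun x => t * Real.sin x - ν * x) (t * Real.cos x - ν) x :=
  (((Real.hasDerivAt_sin x).const_mul t).sub ((hasDerivAt_id x).const_mul ν)).congr_deriv
    (by rw [mul_one])

lemma besselJ_recurrence (t : ℝ) (n : ℤ) :
    t * (besselJ (n + 1 : ℤ) t + besselJ (n - 1 : ℤ) t) = 2 * n * besselJ n t := by
  have key := intervalIntegral.integral_eq_sub_of_hasDerivAt (a := 0) (b := π)
    (fun x _ => ((hasDerivAt_phase t n x).sin).const_mul 2)
    (Continuous.intervalIntegrable (by fun_prop) _ _)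
  have hsplit : ∫ x in (0:ℝ)..π, 2 * (Real.cos (t * Real.sin x - n * x) * (t * Real.cos x - n))
      = t * ((∫ x in (0:ℝ)..π, Real.cos (t * Real.sin x - (n + 1 : ℤ) * x))
          + ∫ x in (0:ℝ)..π, Real.cos (t * Real.sin x - (n - 1 : ℤ) * x))
        - 2 * n * ∫ x in (0:ℝ)..π, Real.cos (t * Real.sin x - n * x) := by
    rw [← intervalIntegral.integral_add (Continuous.intervalIntegrable (by fun_prop) _ _)
      (Continuous.intervalIntegrable (by fun_prop) _ _), ← intervalIntegral.integral_const_mul,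
      ← intervalIntegral.integral_const_mul, ← intervalIntegral.integral_sub
      (Continuous.intervalIntegrable (by fun_prop) _ _)
      (Continuous.intervalIntegrable (by fun_prop) _ _)]
    refine intervalIntegral.integral_congr fun x _ => ?_
    push_cast
    rw [show t * Real.sin x - (n + 1) * x = (t * Real.sin x - n * x) - x by ring,
      show t * Real.sin x - (n - 1) * x = (t * Real.sin x - n * x) + x by ring,
      Real.cos_sub _ x, Real.cos_add _ x]
    ring
  rw [hsplit] at key
  simp [Real.sin_int_mul_pi] at key
  simp only [besselJ_intCast]
  push_cast
  linear_combination 1 / π * key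

lemma integral_mul_sin_recurrence (t : ℝ) (n : ℤ) :
    t * ((∫ x in (0:ℝ)..π, (x - π / 2) * Real.sin (t * Real.sin x - (n + 1 : ℤ) * x))
        + ∫ x in (0:ℝ)..π, (x - π / 2) * Real.sin (t * Real.sin x - (n - 1 : ℤ) * x))
      - 2 * n * (∫ x in (0:ℝ)..π, (x - π / 2) * Real.sin (t * Real.sin x - n * x))
      = 2 * π * besselJ n t - π * (1 + (-1) ^ n) := by
  have key := intervalIntegral.integral_eq_sub_of_hasDerivAt (a := 0) (b := π)
    (fun x _ => (((hasDerivAt_id x).sub_const (π / 2)).mul (hasDerivAt_phase t n x).cos).const_mul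
      (-2))
    (Continuous.intervalIntegrable (by simp only [id]; fun_prop) _ _)
  have hsplit : ∫ x in (0:ℝ)..π, -2 * (1 * Real.cos (t * Real.sin x - n * x)
        + (id x - π / 2) * (-Real.sin (t * Real.sin x - n * x) * (t * Real.cos x - n)))
      = t * ((∫ x in (0:ℝ)..π, (x - π / 2) * Real.sin (t * Real.sin x - (n + 1 : ℤ) * x))
          + ∫ x in (0:ℝ)..π, (x - π / 2) * Real.sin (t * Real.sin x - (n - 1 : ℤ) * x))
        - 2 * n * (∫ x in (0:ℝ)..π, (x - π / 2) * Real.sin (t * Real.sin x - n * x))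
        - 2 * ∫ x in (0:ℝ)..π, Real.cos (t * Real.sin x - n * x) := by
    rw [← intervalIntegral.integral_add (Continuous.intervalIntegrable (by fun_prop) _ _)
      (Continuous.intervalIntegrable (by fun_prop) _ _), ← intervalIntegral.integral_const_mul,
      ← intervalIntegral.integral_const_mul, ← intervalIntegral.integral_const_mul,
      ← intervalIntegral.integral_sub
      (Continuous.intervalIntegrable (by fun_prop) _ _)
      (Continuous.intervalIntegrable (by fun_prop) _ _), ← intervalIntegral.integral_sub
      (Continuous.intervalIntegrable (by fun_prop) _ _)
      (Continuous.intervalIntegrable (by fun_prop) _ _)]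
    refine intervalIntegral.integral_congr fun x _ => ?_
    push_cast
    simp only [id]
    rw [show t * Real.sin x - (n + 1) * x = (t * Real.sin x - n * x) - x by ring,
      show t * Real.sin x - (n - 1) * x = (t * Real.sin x - n * x) + x by ring,
      Real.sin_sub _ x, Real.sin_add _ x]
    ring
  erw [hsplit] at key
  have hcos : Real.cos (t * Real.sin π - n * π) = (-1) ^ n := by
    rw [Real.sin_pi, mul_zero, zero_sub, Real.cos_neg, Real.cos_int_mul_pi]
  have hJ : π * besselJ n t = ∫ x in (0:ℝ)..π, Real.cos (t * Real.sin x - n * x) := by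
    rw [besselJ_intCast]
    have := Real.pi_ne_zero
    field_simp
  simp only [Pi.mul_apply, id, hcos, Real.sin_zero, mul_zero, sub_zero, Real.cos_zero, ← hJ] at key
  linear_combination key

lemma besselDefect_recurrence {t : ℝ} (ht : 0 < t) (n : ℤ) :
    t * (besselDefect t (n + 1) + besselDefect t (n - 1))
      = 2 * n * besselDefect t n + 4 * besselJ n t := by
  have hI := integral_mul_sin_recurrence t n
  have hp := schlaefliExp_recurrence ht n
  have hm := schlaefliExp_recurrence ht (-n)
  have hsign : (-1 : ℝ) ^ (n + 1) = -(-1) ^ n := by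
    rw [zpow_add_one₀ (by norm_num)]; ring
  have hsign' : (-1 : ℝ) ^ (n - 1) = -(-1) ^ n := by
    rw [zpow_sub_one₀ (by norm_num)]; norm_num
  rw [besselDefect, besselDefect, besselDefect, hsign, hsign']
  push_cast at hI ⊢
  rw [show -((n : ℝ) + 1) = -n - 1 by ring, show -((n : ℝ) - 1) = -n + 1 by ring]
  field_simp at hp hm
  linear_combination 2 / π * hI + hp + (-1) ^ n * hm +
    (4 * besselJ n t - 2 * (1 + (-1) ^ n)) * mul_inv_cancel₀ Real.pi_ne_zero

lemma besselDefect_neg (t : ℝ) (n : ℤ) :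
    besselDefect t (-n) = -(-1) ^ n * besselDefect t n := by
  have hI : ∫ x in (0:ℝ)..π, (x - π / 2) * Real.sin (t * Real.sin x - (-n : ℤ) * x)
      = -(-1) ^ n * ∫ x in (0:ℝ)..π, (x - π / 2) * Real.sin (t * Real.sin x - n * x) := by
    have h := intervalIntegral.integral_comp_sub_left
      (fun x => (x - π / 2) * Real.sin (t * Real.sin x - (-n : ℤ) * x)) (a := 0) (b := π) π
    rw [sub_self, sub_zero] at h
    rw [← h, ← intervalIntegral.integral_const_mul]
    refine intervalIntegral.integral_congr fun x _ => ?_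
    push_cast
    simp only [Real.sin_pi_sub]
    rw [show t * Real.sin x - -n * (π - x) = n * π + (t * Real.sin x - n * x) by ring,
      Real.sin_add, Real.sin_int_mul_pi, Real.cos_int_mul_pi]
    ring
  have hsq : ((-1 : ℝ) ^ n) * (-1) ^ n = 1 := by
    rw [← mul_zpow]; norm_num
  have hinv : (-1 : ℝ) ^ (-n) = (-1) ^ n := by
    rw [zpow_neg, ← inv_zpow]; norm_num
  rw [besselDefect, besselDefect, hI, hinv]
  push_cast
  rw [neg_neg]
  linear_combination -schlaefliExp t (-n) * hsq

/-! ### Solving the recurrence -/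

/-- The finite sum `∑_{k < m} m! / (k! (m - k)) s ^ k J k` solves an inhomogeneous three-term
recurrence whenever `J` satisfies the recurrence of the Bessel functions at `2 s`. -/
lemma sum_factorial_div_recurrence {s : ℝ} {J : ℕ → ℝ}
    (hJ : ∀ k : ℕ, s * (J (k + 2) + J k) = (k + 1) * J (k + 1)) (m : ℕ) :
    ∑ k ∈ Finset.range (m + 2), ((m + 2).factorial : ℝ) / (k.factorial * ((m + 2 : ℕ) - k))
        * s ^ k * J k
      = (m + 1) * ∑ k ∈ Finset.range (m + 1),
          ((m + 1).factorial : ℝ) / (k.factorial * ((m + 1 : ℕ) - k)) * s ^ k * J k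
        - s ^ 2 * ∑ k ∈ Finset.range m, (m.factorial : ℝ) / (k.factorial * (m - k)) * s ^ k * J k
        + 2 * s ^ (m + 1) * J (m + 1) := by
  have hshift₁ : ∑ k ∈ Finset.range m,
      (m.factorial : ℝ) / (k.factorial * (m - k)) * ((k + 1) * (s ^ (k + 1) * J (k + 1)))
      = ∑ k ∈ Finset.range (m + 1),
        m.factorial * (k : ℝ) ^ 2 / (k.factorial * ((m + 1 : ℕ) - k)) * (s ^ k * J k) := by
    rw [Finset.sum_range_succ']
    simp only [Nat.cast_zero, ne_eq, OfNat.ofNat_ne_zero, not_false_eq_true, zero_pow, mul_zero,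
      zero_div, zero_mul, add_zero]
    refine Finset.sum_congr rfl fun k hk => ?_
    have hk' : (m : ℝ) - k ≠ 0 := by
      have : (k : ℝ) < m := by exact_mod_cast Finset.mem_range.1 hk
      linarith
    rw [Nat.factorial_succ]
    push_cast
    rw [add_sub_add_right_eq_sub]
    field_simp
  have hshift₂ : ∑ k ∈ Finset.range m,
      (m.factorial : ℝ) / (k.factorial * (m - k)) * (s ^ (k + 2) * J (k + 2))
      = ∑ k ∈ Finset.range (m + 2),
        m.factorial * ((k : ℝ) * (k - 1)) / (k.factorial * ((m + 2 : ℕ) - k))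
          * (s ^ k * J k) := by
    rw [Finset.sum_range_succ', Finset.sum_range_succ']
    simp only [Nat.cast_zero, zero_add, Nat.cast_one, sub_self, mul_zero, zero_mul, zero_div,
      add_zero]
    refine Finset.sum_congr rfl fun k hk => ?_
    have hk' : (m : ℝ) - k ≠ 0 := by
      have : (k : ℝ) < m := by exact_mod_cast Finset.mem_range.1 hk
      linarith
    rw [Nat.factorial_succ, Nat.factorial_succ]
    push_cast
    rw [show (m : ℝ) + 2 - (k + 1 + 1) = m - k by ring]
    field_simp
    ring
  have hlow : s ^ 2 * ∑ k ∈ Finset.range m,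
      (m.factorial : ℝ) / (k.factorial * (m - k)) * s ^ k * J k
      = ∑ k ∈ Finset.range (m + 1),
          m.factorial * (k : ℝ) ^ 2 / (k.factorial * ((m + 1 : ℕ) - k)) * (s ^ k * J k)
        - ∑ k ∈ Finset.range (m + 2),
          m.factorial * ((k : ℝ) * (k - 1)) / (k.factorial * ((m + 2 : ℕ) - k))
            * (s ^ k * J k) := by
    rw [← hshift₁, ← hshift₂, ← Finset.sum_sub_distrib, Finset.mul_sum]
    refine Finset.sum_congr rfl fun k _ => ?_
    linear_combination (m.factorial : ℝ) / (k.factorial * (m - k)) * s ^ (k + 1) * hJ k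
  rw [hlow, Finset.sum_range_succ _ (m + 1), Finset.sum_range_succ _ (m + 1), Finset.mul_sum]
  have hbulk : ∑ k ∈ Finset.range (m + 1),
      ((m + 2).factorial : ℝ) / (k.factorial * ((m + 2 : ℕ) - k)) * s ^ k * J k
      = ∑ k ∈ Finset.range (m + 1),
          (m + 1) * (((m + 1).factorial : ℝ) / (k.factorial * ((m + 1 : ℕ) - k)) * s ^ k * J k)
        - ∑ k ∈ Finset.range (m + 1),
          m.factorial * (k : ℝ) ^ 2 / (k.factorial * ((m + 1 : ℕ) - k)) * (s ^ k * J k)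
        + ∑ k ∈ Finset.range (m + 1),
          m.factorial * ((k : ℝ) * (k - 1)) / (k.factorial * ((m + 2 : ℕ) - k))
            * (s ^ k * J k) := by
    rw [← Finset.sum_sub_distrib, ← Finset.sum_add_distrib]
    refine Finset.sum_congr rfl fun k hk => ?_
    have hk' : (k : ℝ) < m + 1 := by exact_mod_cast Finset.mem_range.1 hk
    have h₁ : (m : ℝ) + 1 - k ≠ 0 := by linarith
    have h₂ : (m : ℝ) + 2 - k ≠ 0 := by linarith
    rw [Nat.factorial_succ (m + 1), Nat.factorial_succ m]
    push_cast
    field_simp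
    ring
  have htop : ((m + 2).factorial : ℝ) / ((m + 1).factorial * ((m + 2 : ℕ) - (m + 1 : ℕ)))
      = m.factorial * (((m + 1 : ℕ) : ℝ) * ((m + 1 : ℕ) - 1))
          / ((m + 1).factorial * ((m + 2 : ℕ) - (m + 1 : ℕ))) + 2 := by
    rw [Nat.factorial_succ (m + 1), Nat.factorial_succ m]
    push_cast
    rw [show (m : ℝ) + 2 - (m + 1) = 1 by ring]
    field_simp
    ring
  linear_combination hbulk + s ^ (m + 1) * J (m + 1) * htop

lemma besselDefect_natCast {t : ℝ} (ht : 0 < t) (m : ℕ) :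
    (t / 2) ^ m * besselDefect t m = ∑ k ∈ Finset.range m,
      (m.factorial : ℝ) / (k.factorial * (m - k)) * (t / 2) ^ k * besselJ k t := by
  have hJ (k : ℕ) : t / 2 * (besselJ ((k + 2 : ℕ) : ℝ) t + besselJ k t)
      = (k + 1) * besselJ ((k + 1 : ℕ) : ℝ) t := by
    have h := besselJ_recurrence t (k + 1)
    rw [show (k : ℤ) + 1 + 1 = (k + 2 : ℕ) by push_cast; ring, add_sub_cancel_right] at h
    push_cast at h ⊢
    linear_combination h / 2
  induction m using Nat.twoStepInduction with
  | zero =>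
    have h := besselDefect_neg t 0
    simp at h ⊢
    linarith
  | one =>
    have h := besselDefect_recurrence ht 0
    have h' := besselDefect_neg t 1
    simp at h h' ⊢
    rw [h'] at h
    linarith
  | more m ih₀ ih₁ =>
    have h := besselDefect_recurrence ht (m + 1)
    rw [show (m : ℤ) + 1 + 1 = (m + 2 : ℕ) by push_cast; ring, add_sub_cancel_right] at h
    rw [sum_factorial_div_recurrence (J := fun k => besselJ k t) hJ, ← ih₀, ← ih₁]
    push_cast at h ⊢
    linear_combination (t / 2) ^ (m + 1) / 2 * h

/-! ### The second derivative -/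

lemma iteratedDeriv_two_sin_mul_add_cos_mul {f g : ℝ → ℝ} (hf : ContDiff ℝ 2 f)
    (hg : ContDiff ℝ 2 g) (n : ℤ) :
    iteratedDeriv 2 (fun ν => Real.sin (ν * π) * f ν + Real.cos (ν * π) * g ν) n
      = (-1) ^ n * (2 * π * deriv f n + iteratedDeriv 2 g n - π ^ 2 * g n) := by
  have hd {h : ℝ → ℝ} (hh : ContDiff ℝ 2 h) (x : ℝ) : HasDerivAt h (deriv h x) x :=
    (hh.differentiable (by norm_num) x).hasDerivAt
  have hdd {h : ℝ → ℝ} (hh : ContDiff ℝ 2 h) (x : ℝ) :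
      HasDerivAt (deriv h) (iteratedDeriv 2 h x) x := by
    rw [iteratedDeriv_succ, iteratedDeriv_one]
    exact ((hh.differentiable_deriv_two) x).hasDerivAt
  have hs (x : ℝ) : HasDerivAt (fun ν => Real.sin (ν * π)) (π * Real.cos (x * π)) x := by
    simpa [mul_comm] using ((hasDerivAt_id x).mul_const π).sin
  have hc (x : ℝ) : HasDerivAt (fun ν => Real.cos (ν * π)) (-(π * Real.sin (x * π))) x := by
    simpa [mul_comm] using ((hasDerivAt_id x).mul_const π).cos
  have hfirst : deriv (fun ν => Real.sin (ν * π) * f ν + Real.cos (ν * π) * g ν)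
      = fun x => π * Real.cos (x * π) * f x + Real.sin (x * π) * deriv f x
        + (-(π * Real.sin (x * π)) * g x + Real.cos (x * π) * deriv g x) :=
    funext fun x => (((hs x).mul (hd hf x)).add ((hc x).mul (hd hg x))).deriv
  rw [iteratedDeriv_succ, iteratedDeriv_one, hfirst]
  refine (((((hc n).const_mul π).mul (hd hf n)).add ((hs n).mul (hdd hf n))).add
    ((((hs n).const_mul π).neg.mul (hd hg n)).add ((hc n).mul (hdd hg n)))).deriv.trans ?_
  rw [Pi.neg_apply, Real.sin_int_mul_pi, Real.cos_int_mul_pi]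
  ring

theorem reflection_second_deriv_besselY_closed_form (t : ℝ) (ht : 0 < t) (m : ℕ) (hm : 1 ≤ m) :
    iteratedDeriv 2 (fun ν : ℝ => besselY ν t) m
      + (-1 : ℝ) ^ (m + 1) * iteratedDeriv 2 (fun ν : ℝ => besselY ν t) (-(m : ℝ))
      = -π * (m.factorial : ℝ) *
          ∑ k ∈ Finset.range m,
            besselJ k t / ((k.factorial : ℝ) * ((m : ℝ) - k)) * (t / 2) ^ ((k : ℤ) - (m : ℤ)) := by
  have hrefl : iteratedDeriv 2 (fun ν : ℝ => besselY ν t) (-(m : ℝ))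
      = (-1) ^ m * (2 * π * deriv (fun ν => besselJ ν t) m
        + iteratedDeriv 2 (fun ν => besselY ν t) m - π ^ 2 * besselY m t) := by
    have h := iteratedDeriv_comp_neg 2 (fun ν => besselY ν t) (m : ℝ)
    simp only [besselY_neg_order ht] at h
    have h' := iteratedDeriv_two_sin_mul_add_cos_mul (contDiff_besselJ ht) (contDiff_besselY ht) m
    simp only [Int.cast_natCast, zpow_natCast] at h'
    simpa [h'] using h.symm
  have hdefect := two_mul_deriv_besselJ_sub_pi_mul_besselY ht m
  have hsum := besselDefect_natCast ht m
  have hs : t / 2 ≠ 0 := by positivity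
  have hsq : ((-1 : ℝ) ^ m) * (-1) ^ m = 1 := by
    rw [← mul_pow]; norm_num
  have hrhs : (m.factorial : ℝ) * ∑ k ∈ Finset.range m,
      besselJ k t / ((k.factorial : ℝ) * ((m : ℝ) - k)) * (t / 2) ^ ((k : ℤ) - (m : ℤ))
      = besselDefect t m := by
    rw [← mul_right_inj' (pow_ne_zero m hs), hsum, Finset.mul_sum, Finset.mul_sum]
    refine Finset.sum_congr rfl fun k _ => ?_
    rw [zpow_sub₀ hs, zpow_natCast, zpow_natCast]
    field_simp
  rw [mul_assoc, hrhs, ← hdefect, hrefl, Int.cast_natCast, pow_succ]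
  linear_combination -(2 * π * deriv (fun ν => besselJ ν t) m
        + iteratedDeriv 2 (fun ν => besselY ν t) m - π ^ 2 * besselY m t) * hsq
end
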